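/- arXiv:2203.15518 — 2 statements merged into one kernel-verified Lean document; each statement's English description precedes it below -/
import Mathlib

section
/- The set of σ-fixed elements of the augmentation ideal, {a ∈ ker ε : σ(a) = a}, equals the R-submodule of L spanned by the elements u^ν + u^{−ν} − 2·u^0 for ν ∈ ℤ^t, ν ≠ 0. -/
noncomputable section

open MvPolynomial

/-- The defining ideal: generated by `x_i y_i + x_i + y_i`, `i = 1,…,t`. -/
def torusRel (R : Type*) [CommRing R] (t : ℕ) : Ideal (MvPolynomial (Fin t ⊕ Fin t) R) :=
  Ideal.span { p | ∃ i : Fin t,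
    p = X (Sum.inl i) * X (Sum.inr i) + X (Sum.inl i) + X (Sum.inr i) }

/-- `A = R[x_1,…,x_t,y_1,…,y_t]/(x_i y_i + x_i + y_i)`. -/
abbrev QA (R : Type*) [CommRing R] (t : ℕ) :=
  MvPolynomial (Fin t ⊕ Fin t) R ⧸ torusRel R t

/-- The image of the variable `x_i` in `A`. -/
def xg (R : Type*) [CommRing R] (t : ℕ) (i : Fin t) : QA R t :=
  Ideal.Quotient.mk _ (X (Sum.inl i))

/-- The image of the variable `y_i` in `A`. -/
def yg (R : Type*) [CommRing R] (t : ℕ) (i : Fin t) : QA R t :=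
  Ideal.Quotient.mk _ (X (Sum.inr i))

/-- `L = R[ℤ^t]`, the group algebra of `ℤ^t` over `R`. -/
abbrev LA (R : Type*) [CommRing R] (t : ℕ) := AddMonoidAlgebra R (Fin t → ℤ)

/-- The basis element `u^ν` of `L = R[ℤ^t]`. -/
def uL (R : Type*) [CommRing R] (t : ℕ) (ν : Fin t → ℤ) : LA R t :=
  AddMonoidAlgebra.single ν 1

/-- The elements `u^ν` span `L`. -/
theorem LA_induction {R : Type*} [CommRing R] {t : ℕ} {P : LA R t → Prop} (a : LA R t)
    (zero : P 0) (add : ∀ a b, P a → P b → P (a + b))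
    (smul_uL : ∀ (r : R) (ν : Fin t → ℤ), P (r • uL R t ν)) : P a := by
  refine AddMonoidAlgebra.induction_linear a zero add fun ν r => ?_
  simpa [uL] using smul_uL r ν

theorem coeff_apply_of_uL_neg {R : Type*} [CommRing R] {t : ℕ}
    (σ : LA R t ≃ₐ[R] LA R t) (hσ : ∀ ν : Fin t → ℤ, σ (uL R t ν) = uL R t (-ν))
    (a : LA R t) (μ : Fin t → ℤ) : (σ a).coeff μ = a.coeff (-μ) := by
  induction a using LA_induction with
  | zero => simp
  | add a b ha hb => simp [ha, hb]
  | smul_uL r ν =>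
    rw [map_smul, hσ]
    simp [uL, Finsupp.single_apply, neg_eq_iff_eq_neg]

theorem augmentation_apply_of_uL_neg {R : Type*} [CommRing R] {t : ℕ}
    (ε : LA R t →ₐ[R] R) (hε : ∀ ν : Fin t → ℤ, ε (uL R t ν) = 1)
    (σ : LA R t ≃ₐ[R] LA R t) (hσ : ∀ ν : Fin t → ℤ, σ (uL R t ν) = uL R t (-ν))
    (a : LA R t) : ε (σ a) = ε a := by
  induction a using LA_induction with
  | zero => simp
  | add a b ha hb => simp only [map_add, ha, hb]
  | smul_uL r ν => simp only [map_smul, hσ, hε]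

/-- The positive cone picks one element out of each pair `{g, -g}`, `g ≠ 0`. -/
theorem exists_pred_neg_iff_not (G : Type*) [AddCommGroup G] [LinearOrder G]
    [IsOrderedAddMonoid G] : ∃ P : G → Prop, ¬ P 0 ∧ ∀ g, g ≠ 0 → (P (-g) ↔ ¬ P g) :=
  ⟨fun g => 0 < g, lt_irrefl 0, fun g hg => by
    beta_reduce
    rw [Left.neg_pos_iff, not_lt]
    exact ⟨le_of_lt, fun h => lt_of_le_of_ne h hg⟩⟩

/-- A `σ`-fixed element is a symmetrization up to a constant: take the part of it supported on
the lexicographically positive exponents. -/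
theorem exists_eq_add_add_smul_one_of_fixed {R : Type*} [CommRing R] {t : ℕ}
    (σ : LA R t ≃ₐ[R] LA R t) (hσ : ∀ ν : Fin t → ℤ, σ (uL R t ν) = uL R t (-ν))
    (a : LA R t) (ha : σ a = a) : ∃ (b : LA R t) (c : R), a = b + σ b + c • 1 := by
  classical
  obtain ⟨P, hP0, hP⟩ : ∃ P : (Fin t → ℤ) → Prop, ¬ P 0 ∧ ∀ ν, ν ≠ 0 → (P (-ν) ↔ ¬ P ν) :=
    exists_pred_neg_iff_not (Lex (Fin t → ℤ))
  refine ⟨.ofCoeff (a.coeff.filter P), a.coeff 0, ?_⟩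
  ext μ
  have hμ : a.coeff (-μ) = a.coeff μ := by rw [← coeff_apply_of_uL_neg σ hσ, ha]
  simp only [AddMonoidAlgebra.coeff_add, Finsupp.add_apply, coeff_apply_of_uL_neg σ hσ,
    AddMonoidAlgebra.coeff_smul, Finsupp.smul_apply, AddMonoidAlgebra.one_def,
    AddMonoidAlgebra.coeff_single, Finsupp.single_apply, Finsupp.filter_apply, hμ]
  by_cases h0 : μ = 0
  · simp [h0, hP0]
  · by_cases h : P μ <;> simp [hP μ h0, h, Ne.symm h0]

theorem add_apply_sub_mem_span {R : Type*} [CommRing R] {t : ℕ}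
    (ε : LA R t →ₐ[R] R) (hε : ∀ ν : Fin t → ℤ, ε (uL R t ν) = 1)
    (σ : LA R t ≃ₐ[R] LA R t) (hσ : ∀ ν : Fin t → ℤ, σ (uL R t ν) = uL R t (-ν))
    (b : LA R t) :
    b + σ b - (2 * ε b) • 1 ∈ Submodule.span R {b : LA R t | ∃ ν : Fin t → ℤ, ν ≠ 0 ∧
      b = uL R t ν + uL R t (-ν) - 2 * uL R t 0} := by
  induction b using LA_induction with
  | zero => simp
  | add a b ha hb =>
    convert add_mem ha hb using 1
    rw [map_add, map_add, mul_add, add_smul]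
    abel
  | smul_uL r ν =>
    have h : r • uL R t ν + σ (r • uL R t ν) - (2 * ε (r • uL R t ν)) • 1 =
        r • (uL R t ν + uL R t (-ν) - 2 * uL R t 0) := by
      rw [map_smul, map_smul, hσ, hε, show uL R t 0 = 1 from rfl, smul_sub, smul_add, smul_eq_mul,
        mul_one, mul_one, mul_comm, mul_smul, ofNat_smul_eq_nsmul, nsmul_one, Nat.cast_ofNat]
    rw [h]
    refine Submodule.smul_mem _ _ ?_
    by_cases hν : ν = 0
    · subst hν
      rw [neg_zero, ← two_mul, sub_self]
      exact zero_mem _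
    · exact Submodule.subset_span ⟨ν, hν, rfl⟩

/-- The `σ`-fixed part of the augmentation ideal `ker ε` of `L = R[ℤ^t]` is the
`R`-submodule spanned by the elements `u^ν + u^{−ν} − 2u^0`, `ν ≠ 0`. -/
theorem stmt4 (R : Type*) [CommRing R] (t : ℕ) (ht : 1 ≤ t)
    (ε : LA R t →ₐ[R] R) (hε : ∀ ν : Fin t → ℤ, ε (uL R t ν) = 1)
    (σ : LA R t ≃ₐ[R] LA R t) (hσ : ∀ ν : Fin t → ℤ, σ (uL R t ν) = uL R t (-ν)) :
    {a : LA R t | ε a = 0 ∧ σ a = a} =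
      ↑(Submodule.span R {b : LA R t | ∃ ν : Fin t → ℤ, ν ≠ 0 ∧
        b = uL R t ν + uL R t (-ν) - 2 * uL R t 0}) := by
  ext a
  constructor
  · rintro ⟨hεa, hσa⟩
    obtain ⟨b, c, rfl⟩ := exists_eq_add_add_smul_one_of_fixed σ hσ a hσa
    have hc : c = -(2 * ε b) := by
      simp only [map_add, map_smul, map_one, augmentation_apply_of_uL_neg ε hε σ hσ, smul_eq_mul,
        mul_one] at hεa
      linear_combination hεa
    rw [hc, neg_smul, ← sub_eq_add_neg]
    exact add_apply_sub_mem_span ε hε σ hσ b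
  · intro ha
    induction ha using Submodule.span_induction with
    | mem x hx =>
      obtain ⟨ν, -, rfl⟩ := hx
      refine ⟨?_, ?_⟩
      · simp only [map_add, map_sub, map_mul, hε, map_ofNat]
        ring
      · simp only [map_add, map_sub, map_mul, hσ, map_ofNat, neg_neg, neg_zero]
        ring
    | zero => simp
    | add x y _ _ hx hy => exact ⟨by simp [hx.1, hy.1], by rw [map_add, hx.2, hy.2]⟩
    | smul r x _ hx => exact ⟨by simp [hx.1], by rw [map_smul, hx.2]⟩
end
end

section
/- The set I_+ = {a ∈ I_A : τ(a) = a} of τ-fixed elements of the ideal I_A is generated as an R-module by the elements x^λ y^μ + x^μ y^λ with λ, μ ∈ ℕ^t and (λ, μ) ≠ (0, 0). (This is the generation claim used in the proof of Lemma 2.6.) -/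
noncomputable section

open MvPolynomial

/-- The ideal `I_A ⊆ A` generated by `x_1,…,x_t,y_1,…,y_t`. -/
def IA (R : Type*) [CommRing R] (t : ℕ) : Ideal (QA R t) :=
  Ideal.span (Set.range (xg R t) ∪ Set.range (yg R t))

/-- The monomial `x^λ y^μ = ∏_i x_i^{λ_i} y_i^{μ_i}` in `A`. -/
def monXY (R : Type*) [CommRing R] (t : ℕ) (lam mu : Fin t → ℕ) : QA R t :=
  ∏ i : Fin t, xg R t i ^ lam i * yg R t i ^ mu i

namespace AddMonoidAlgebra

/-- The augmentation `R[G] → R`. -/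
def augmentation (R G : Type*) [CommRing R] [AddCommGroup G] : AddMonoidAlgebra R G →ₐ[R] R :=
  lift R R G 1

lemma augmentation_single {R G : Type*} [CommRing R] [AddCommGroup G] (g : G) (r : R) :
    augmentation R G (single g r) = r := by
  simp [augmentation, lift_single]

/-- In a group algebra of a group without elements of order two, an element invariant under
inversion is congruent to its augmentation modulo the elements `g + g⁻¹ - 2`. -/
lemma sub_augmentation_mem_span {R G : Type*} [CommRing R] [AddCommGroup G]
    (hG : ∀ g : G, -g = g → g = 0) (f : AddMonoidAlgebra R G)
    (hf : ∀ g, f.coeff (-g) = f.coeff g) :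
    f - single 0 (augmentation R G f) ∈ Submodule.span R
      (Set.range fun g : G ↦ (single g 1 + single (-g) 1 - 2 : AddMonoidAlgebra R G)) := by
  classical
  induction hn : f.coeff.support.card using Nat.strong_induction_on generalizing f with
  | _ n ih =>
  by_cases h : ∃ g ∈ f.coeff.support, g ≠ 0
  · obtain ⟨g, hg, hg0⟩ := h
    have hgg : -g ≠ g := fun h ↦ hg0 (hG g h)
    set c := f.coeff g with hc
    set f' : AddMonoidAlgebra R G := f - c • (single g 1 + single (-g) 1) with hf'
    have hcoeff (k : G) : f'.coeff k = if k = g ∨ k = -g then 0 else f.coeff k := by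
      have h1 : f'.coeff k
          = f.coeff k - c * ((if g = k then 1 else 0) + (if -g = k then 1 else 0)) := by
        simp [hf', Finsupp.single_apply, mul_add]
      rw [h1]
      rcases eq_or_ne k g with rfl | h1
      · simp [hgg, hc]
      rcases eq_or_ne k (-g) with rfl | h2
      · simp [hgg.symm, hf, hc]
      · simp [h1, h2, h1.symm, h2.symm]
    have hsub : f'.coeff.support ⊂ f.coeff.support := by
      refine Finset.ssubset_iff_of_subset ?_ |>.2 ⟨g, hg, by simp [hcoeff]⟩
      intro k hk
      rw [Finsupp.mem_support_iff, hcoeff] at hk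
      rw [Finsupp.mem_support_iff]
      exact fun h ↦ hk (by simp [h])
    have key := ih _ (hn ▸ Finset.card_lt_card hsub) f' (fun k ↦ by
      simp only [hcoeff, hf, neg_eq_iff_eq_neg, neg_neg, or_comm]) rfl
    have haug : augmentation R G f' = augmentation R G f - c * 2 := by
      simp only [hf', map_sub, map_smul, map_add, augmentation_single, smul_eq_mul]
      ring
    have heq : f - single 0 (augmentation R G f) =
        (f' - single 0 (augmentation R G f'))
          + c • (single g 1 + single (-g) 1 - 2 : AddMonoidAlgebra R G) := by
      have h2 : (single 0 (c * 2) : AddMonoidAlgebra R G) = c • 2 := by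
        rw [← smul_eq_mul, ← smul_single, ← one_add_one_eq_two, single_add, ← one_def,
          one_add_one_eq_two]
      rw [haug, single_sub, h2, hf', smul_sub]
      abel
    rw [heq]
    exact add_mem key (Submodule.smul_mem _ _ (Submodule.subset_span ⟨g, rfl⟩))
  · push Not at h
    have hf0 : f = single 0 (f.coeff 0) := by
      ext k
      rcases eq_or_ne k 0 with rfl | hk
      · simp
      · have : f.coeff k = 0 := by
          by_contra h'
          exact hk (h k (Finsupp.mem_support_iff.2 h'))
        simp [this, hk.symm]
    rw [hf0, augmentation_single, sub_self]
    exact zero_mem _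

end AddMonoidAlgebra

section

variable (R : Type*) [CommRing R] (t : ℕ)

lemma xg_mul_yg (i : Fin t) : xg R t i * yg R t i + xg R t i + yg R t i = 0 := by
  simp only [xg, yg, ← map_mul, ← map_add]
  exact Ideal.Quotient.eq_zero_iff_mem.2 (Ideal.subset_span ⟨i, rfl⟩)

/-- The unit `1 + x_i` of `A`, with inverse `1 + y_i`. -/
def unitXg (i : Fin t) : (QA R t)ˣ where
  val := 1 + xg R t i
  inv := 1 + yg R t i
  val_inv := by linear_combination xg_mul_yg R t i
  inv_val := by linear_combination xg_mul_yg R t i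

/-- The monomials `u^ν` in the units `1 + x_i`, as a homomorphism in the exponent `ν`. -/
def unitMonomial : Multiplicative (Fin t → ℤ) →* (QA R t)ˣ :=
  MonoidHom.mk' (fun ν ↦ ∏ i, unitXg R t i ^ (ν.toAdd i)) fun a b ↦ by
    simp [zpow_add, Finset.prod_mul_distrib]

/-- The homomorphism `L → A` with `u_i ↦ 1 + x_i`. -/
def ofLaurent : LA R t →ₐ[R] QA R t :=
  AddMonoidAlgebra.lift R (QA R t) (Fin t → ℤ) ((Units.coeHom _).comp (unitMonomial R t))

lemma ofLaurent_uL (ν : Fin t → ℤ) :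
    ofLaurent R t (uL R t ν) = (unitMonomial R t (Multiplicative.ofAdd ν) : QA R t) := by
  simp [ofLaurent, uL, AddMonoidAlgebra.lift_single]

lemma uL_add (μ ν : Fin t → ℤ) : uL R t (μ + ν) = uL R t μ * uL R t ν := by
  simp [uL, AddMonoidAlgebra.single_mul_single]

lemma uL_zero : uL R t 0 = 1 := rfl

/-- The homomorphism `A → L` with `x_i ↦ u_i - 1` and `y_i ↦ u_i⁻¹ - 1`. -/
def toLaurent : QA R t →ₐ[R] LA R t :=
  Ideal.Quotient.liftₐ (torusRel R t)
    (aeval (Sum.elim (fun i ↦ uL R t (Pi.single i 1) - 1) fun i ↦ uL R t (-Pi.single i 1) - 1)) <| by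
    suffices torusRel R t ≤ RingHom.ker (aeval (R := R) (Sum.elim
        (fun i ↦ uL R t (Pi.single i 1) - 1) fun i ↦ uL R t (-Pi.single i 1) - 1)) from
      fun a ha ↦ this ha
    refine Ideal.span_le.2 ?_
    rintro _ ⟨i, rfl⟩
    have h : uL R t (Pi.single i 1) * uL R t (-Pi.single i 1) = 1 := by
      rw [← uL_add, add_neg_cancel, uL_zero]
    simp only [SetLike.mem_coe, RingHom.mem_ker, map_add, map_mul, aeval_X, Sum.elim_inl,
      Sum.elim_inr]
    linear_combination h

lemma toLaurent_xg (i : Fin t) : toLaurent R t (xg R t i) = uL R t (Pi.single i 1) - 1 := by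
  simp only [toLaurent, xg]
  exact (Ideal.Quotient.lift_mk ..).trans (by simp)

lemma toLaurent_yg (i : Fin t) : toLaurent R t (yg R t i) = uL R t (-Pi.single i 1) - 1 := by
  simp only [toLaurent, yg]
  exact (Ideal.Quotient.lift_mk ..).trans (by simp)

variable {R t}

lemma QA.algHom_ext {B : Type*} [Semiring B] [Algebra R B] {f g : QA R t →ₐ[R] B}
    (hx : ∀ i, f (xg R t i) = g (xg R t i)) (hy : ∀ i, f (yg R t i) = g (yg R t i)) : f = g := by
  refine Ideal.Quotient.algHom_ext _ (MvPolynomial.algHom_ext ?_)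
  rintro (i | i)
  · exact hx i
  · exact hy i

variable (R t)

lemma unitMonomial_single (i : Fin t) :
    unitMonomial R t (Multiplicative.ofAdd (Pi.single i 1)) = unitXg R t i := by
  classical
  simp only [unitMonomial, MonoidHom.mk'_apply, toAdd_ofAdd]
  rw [Finset.prod_eq_single i] <;> simp +contextual

lemma ofLaurent_toLaurent (a : QA R t) : ofLaurent R t (toLaurent R t a) = a := by
  suffices (ofLaurent R t).comp (toLaurent R t) = AlgHom.id R _ from DFunLike.congr_fun this a
  refine QA.algHom_ext (fun i ↦ ?_) fun i ↦ ?_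
  · simp [toLaurent_xg, ofLaurent_uL, unitMonomial_single, unitXg]
  · simp [toLaurent_yg, ofLaurent_uL, unitMonomial_single, unitXg, ofAdd_neg]

lemma augmentation_toLaurent {a : QA R t} (ha : a ∈ IA R t) :
    AddMonoidAlgebra.augmentation R _ (toLaurent R t a) = 0 := by
  suffices IA R t ≤
      RingHom.ker ((AddMonoidAlgebra.augmentation R (Fin t → ℤ)).comp (toLaurent R t)) from this ha
  refine Ideal.span_le.2 ?_
  rintro _ (⟨i, rfl⟩ | ⟨i, rfl⟩) <;>
    simp [RingHom.mem_ker, toLaurent_xg, toLaurent_yg, uL, AddMonoidAlgebra.augmentation_single]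

variable {R t} in
lemma map_unitMonomial_eq_one {B : Type*} [CommRing B] (f : QA R t →+* B)
    (hf : ∀ i, f (xg R t i) = 0) (ν : Multiplicative (Fin t → ℤ)) :
    f (unitMonomial R t ν) = 1 := by
  have h (i : Fin t) : Units.map (f : QA R t →* B) (unitXg R t i) = 1 := by
    ext
    simp [unitXg, hf]
  have h' : Units.map (f : QA R t →* B) (unitMonomial R t ν) = 1 := by
    simp [unitMonomial, h]
  simpa using congr_arg Units.val h'

lemma unitMonomial_sub_one_mem (ν : Multiplicative (Fin t → ℤ)) :
    (unitMonomial R t ν : QA R t) - 1 ∈ IA R t := by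
  have hx (i : Fin t) : xg R t i ∈ IA R t := Ideal.subset_span (Or.inl ⟨i, rfl⟩)
  have h := map_unitMonomial_eq_one (R := R) (B := QA R t ⧸ IA R t) (Ideal.Quotient.mk (IA R t))
    (fun i ↦ Ideal.Quotient.eq_zero_iff_mem.2 (hx i)) ν
  rwa [← map_one (Ideal.Quotient.mk (IA R t)), Ideal.Quotient.eq] at h

lemma monXY_add (a b c d : Fin t → ℕ) :
    monXY R t a b * monXY R t c d = monXY R t (a + c) (b + d) := by
  simp only [monXY, ← Finset.prod_mul_distrib, Pi.add_apply, pow_add]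
  exact Finset.prod_congr rfl fun _ _ ↦ by ring

lemma monXY_single_zero (i : Fin t) : monXY R t (Pi.single i 1) 0 = xg R t i := by
  rw [monXY, Finset.prod_eq_single i] <;> simp +contextual

lemma monXY_zero_single (i : Fin t) : monXY R t 0 (Pi.single i 1) = yg R t i := by
  rw [monXY, Finset.prod_eq_single i] <;> simp +contextual

lemma span_monXY_eq_top :
    Submodule.span R (Set.range fun p : (Fin t → ℕ) × (Fin t → ℕ) ↦ monXY R t p.1 p.2) = ⊤ := by
  refine eq_top_iff.2 fun a _ ↦ ?_
  obtain ⟨p, rfl⟩ := Ideal.Quotient.mk_surjective a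
  induction p using MvPolynomial.induction_on' with
  | monomial u r =>
    have : Ideal.Quotient.mk (torusRel R t) (monomial u r) =
        r • monXY R t (fun i ↦ u (Sum.inl i)) (fun i ↦ u (Sum.inr i)) := by
      rw [MvPolynomial.monomial_eq, Finsupp.prod_fintype _ _ (by simp), ← smul_eq_C_mul,
        ← Ideal.Quotient.mkₐ_eq_mk R, map_smul]
      simp [monXY, xg, yg, Finset.prod_mul_distrib]
    rw [this]
    exact Submodule.smul_mem _ _ (Submodule.subset_span ⟨(_, _), rfl⟩)
  | add p q hp hq =>
    rw [map_add]
    exact add_mem (hp trivial) (hq trivial)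

lemma mem_span_monXY_of_mem_IA {a : QA R t} (ha : a ∈ IA R t) :
    a ∈ Submodule.span R {b : QA R t | ∃ lam mu : Fin t → ℕ, (lam, mu) ≠ (0, 0) ∧
        b = monXY R t lam mu} := by
  have h := Submodule.span_smul_of_span_eq_top (span_monXY_eq_top R t)
    (Set.range (xg R t) ∪ Set.range (yg R t))
  have ha' : a ∈ (Submodule.span (QA R t)
      (Set.range (xg R t) ∪ Set.range (yg R t))).restrictScalars R := ha
  rw [← h] at ha'
  refine Submodule.span_mono ?_ ha'
  rintro _ ⟨_, ⟨⟨c, d⟩, rfl⟩, _, (⟨i, rfl⟩ | ⟨i, rfl⟩), rfl⟩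
  · refine ⟨c + Pi.single i 1, d, fun h ↦ ?_, ?_⟩
    · simpa using congr_fun (congr_arg Prod.fst h) i
    · simp only [smul_eq_mul, ← monXY_single_zero, monXY_add, add_zero]
  · refine ⟨c, d + Pi.single i 1, fun h ↦ ?_, ?_⟩
    · simpa using congr_fun (congr_arg Prod.snd h) i
    · simp only [smul_eq_mul, ← monXY_zero_single, monXY_add, add_zero]

lemma monXY_mem_IA {lam mu : Fin t → ℕ} (h : (lam, mu) ≠ (0, 0)) : monXY R t lam mu ∈ IA R t := by
  obtain ⟨i, hi⟩ : ∃ i, lam i ≠ 0 ∨ mu i ≠ 0 := by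
    by_contra! h'
    exact h (Prod.ext (funext fun i ↦ (h' i).1) (funext fun i ↦ (h' i).2))
  refine Ideal.mem_of_dvd (IA R t)
    (Finset.dvd_prod_of_mem (fun i ↦ xg R t i ^ lam i * yg R t i ^ mu i) (Finset.mem_univ i)) ?_
  rcases hi with hi | hi
  · have hx : xg R t i ∈ IA R t := Ideal.subset_span (Or.inl ⟨i, rfl⟩)
    exact Ideal.mul_mem_right _ _ (Ideal.pow_mem_of_mem _ hx _ (Nat.pos_of_ne_zero hi))
  · have hy : yg R t i ∈ IA R t := Ideal.subset_span (Or.inr ⟨i, rfl⟩)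
    exact Ideal.mul_mem_left _ _ (Ideal.pow_mem_of_mem _ hy _ (Nat.pos_of_ne_zero hi))

variable {R t} {τ : QA R t ≃ₐ[R] QA R t}

lemma map_monXY (hτx : ∀ i, τ (xg R t i) = yg R t i) (hτy : ∀ i, τ (yg R t i) = xg R t i)
    (lam mu : Fin t → ℕ) : τ (monXY R t lam mu) = monXY R t mu lam := by
  simp [monXY, hτx, hτy, mul_comm]

lemma add_map_mem_span (hτx : ∀ i, τ (xg R t i) = yg R t i)
    (hτy : ∀ i, τ (yg R t i) = xg R t i) {a : QA R t} (ha : a ∈ IA R t) :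
    a + τ a ∈ Submodule.span R {b : QA R t | ∃ lam mu : Fin t → ℕ, (lam, mu) ≠ (0, 0) ∧
        b = monXY R t lam mu + monXY R t mu lam} := by
  refine (Submodule.span_le (p := (Submodule.span R _).comap
    (LinearMap.id + τ.toLinearMap))).2 ?_ (mem_span_monXY_of_mem_IA R t ha)
  rintro _ ⟨lam, mu, h, rfl⟩
  exact Submodule.subset_span ⟨lam, mu, h, by simp [map_monXY hτx hτy]⟩

lemma map_unitMonomial (hτx : ∀ i, τ (xg R t i) = yg R t i) (ν : Multiplicative (Fin t → ℤ)) :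
    τ (unitMonomial R t ν) = (unitMonomial R t ν⁻¹ : QA R t) := by
  have h (i : Fin t) : Units.map (τ : QA R t →* QA R t) (unitXg R t i) = (unitXg R t i)⁻¹ := by
    ext
    simp [unitXg, hτx]
  have h' : Units.map (τ : QA R t →* QA R t) (unitMonomial R t ν) = unitMonomial R t ν⁻¹ := by
    simp [unitMonomial, h]
  simpa using congr_arg Units.val h'

lemma toLaurent_map (hτx : ∀ i, τ (xg R t i) = yg R t i)
    (hτy : ∀ i, τ (yg R t i) = xg R t i) (a : QA R t) :
    toLaurent R t (τ a) =
      AddMonoidAlgebra.domCongr R R (AddEquiv.neg (Fin t → ℤ)) (toLaurent R t a) := by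
  suffices (toLaurent R t).comp (τ : QA R t →ₐ[R] QA R t) = ((AddMonoidAlgebra.domCongr R R
      (AddEquiv.neg (Fin t → ℤ)) : LA R t →ₐ[R] LA R t)).comp (toLaurent R t) from
    DFunLike.congr_fun this a
  refine QA.algHom_ext (fun i ↦ ?_) fun i ↦ ?_ <;>
    simp [hτx, hτy, toLaurent_xg, toLaurent_yg, uL]

end

/-- `I_+ = {a ∈ I_A : τ(a) = a}` is generated as an `R`-module by the elements
`x^λ y^μ + x^μ y^λ` with `(λ, μ) ≠ (0, 0)`. -/
theorem stmt5 (R : Type*) [CommRing R] (t : ℕ) (ht : 1 ≤ t)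
    (τ : QA R t ≃ₐ[R] QA R t)
    (hτx : ∀ i : Fin t, τ (xg R t i) = yg R t i)
    (hτy : ∀ i : Fin t, τ (yg R t i) = xg R t i) :
    {a : QA R t | a ∈ IA R t ∧ τ a = a} =
      ↑(Submodule.span R {b : QA R t | ∃ lam mu : Fin t → ℕ, (lam, mu) ≠ (0, 0) ∧
        b = monXY R t lam mu + monXY R t mu lam}) := by
  refine Set.Subset.antisymm ?_ fun a ha ↦ ?_
  · rintro a ⟨haI, hτa⟩
    have hsymm (g : Fin t → ℤ) : (toLaurent R t a).coeff (-g) = (toLaurent R t a).coeff g := by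
      conv_rhs => rw [← hτa, toLaurent_map hτx hτy]
      simp
    have h := AddMonoidAlgebra.sub_augmentation_mem_span
      (fun g (hg : -g = g) ↦ neg_eq_self.1 hg) _ hsymm
    rw [augmentation_toLaurent R t haI, AddMonoidAlgebra.single_zero, sub_zero] at h
    rw [← ofLaurent_toLaurent R t a]
    refine (Submodule.span_le (p := (Submodule.span R _).comap (ofLaurent R t).toLinearMap)).2 ?_ h
    rintro _ ⟨ν, rfl⟩
    have key := add_map_mem_span hτx hτy (unitMonomial_sub_one_mem R t (Multiplicative.ofAdd ν))
    rw [map_sub, map_one, map_unitMonomial hτx, ← ofAdd_neg, ← ofLaurent_uL, ← ofLaurent_uL] at key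
    rw [SetLike.mem_coe, Submodule.mem_comap]
    convert key using 1
    simp only [AlgHom.toLinearMap_apply, map_sub, map_add, map_ofNat, uL]
    ring
  · refine Submodule.span_induction (p := fun a _ ↦ a ∈ IA R t ∧ τ a = a) ?_ ?_ ?_ ?_ ha
    · rintro _ ⟨lam, mu, h, rfl⟩
      refine ⟨add_mem (monXY_mem_IA R t h) (monXY_mem_IA R t fun h' ↦ h ?_), ?_⟩
      · simp_all
      · rw [map_add, map_monXY hτx hτy, map_monXY hτx hτy, add_comm]
    · simp
    · rintro x y - - ⟨hx, hx'⟩ ⟨hy, hy'⟩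
      exact ⟨add_mem hx hy, by rw [map_add, hx', hy']⟩
    · rintro r x - ⟨hx, hx'⟩
      exact ⟨Submodule.smul_of_tower_mem _ r hx, by rw [map_smul, hx']⟩
end
end
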